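/- arXiv:2010.01643 — 6 statements merged into one kernel-verified Lean document; each statement's English description precedes it below -/
import Mathlib

section
/- Suppose that for each index a with w_a = 0 we have f_a = 0, and that for each index a with w_a ≥ 1 the smooth function f_a : ℝⁿ → ℝ is a finite sum f_a(x) = ∑_s g_{a,s}(x⁰)·x^s over multi-indices s supported on the positive-weight coordinates with w·s < w_a, where x⁰ denotes the tuple of weight-zero coordinates of x and each g_{a,s} is a smooth function of x⁰. Then the vector field X = (f₁,…,f_n) on ℝⁿ is complete: for every x₀ ∈ ℝⁿ there is a curve γ : ℝ → ℝⁿ with γ(0) = x₀ and γ'(t) = X(γ(t)) for all t ∈ ℝ. -/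
open scoped BigOperators

/-- A continuous vector field on `ℝⁿ` that is strictly triangular with respect to a weight
function (each component depends only on coordinates of strictly smaller weight) has global
integral curves, obtained by successive integration. -/
theorem exists_integralCurve_of_triangular {ι : Type*} [Fintype ι] (w : ι → ℕ)
    (f : ι → (ι → ℝ) → ℝ) (hf : ∀ a, Continuous (f a))
    (hdep : ∀ a x y, (∀ b, w b < w a → x b = y b) → f a x = f a y) (x₀ : ι → ℝ) :
    ∃ γ : ℝ → (ι → ℝ), γ 0 = x₀ ∧ ∀ t : ℝ, HasDerivAt γ (fun a => f a (γ t)) t := by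
  have key : ∀ k : ℕ, ∃ γ : ℝ → (ι → ℝ), γ 0 = x₀ ∧ Continuous γ ∧
      ∀ a, w a < k → ∀ t, HasDerivAt (fun t => γ t a) (f a (γ t)) t := by
    intro k
    induction k with
    | zero => exact ⟨fun _ => x₀, rfl, continuous_const, fun a ha => absurd ha (Nat.not_lt_zero _)⟩
    | succ k ih =>
      obtain ⟨γ, hγ0, hγc, hγ⟩ := ih
      have hint : ∀ a t, HasDerivAt (fun t => x₀ a + ∫ s in (0 : ℝ)..t, f a (γ s))
          (f a (γ t)) t := fun a t =>
        (((hf a).comp hγc).integral_hasStrictDerivAt 0 t).hasDerivAt.const_add (x₀ a)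
      refine ⟨fun t a => if w a < k then γ t a else x₀ a + ∫ s in (0 : ℝ)..t, f a (γ s),
        ?_, ?_, ?_⟩
      · ext a
        simp [hγ0]
      · refine continuous_pi fun a => ?_
        by_cases ha : w a < k
        · simp only [if_pos ha]
          exact (continuous_apply a).comp hγc
        · simp only [if_neg ha]
          exact continuous_iff_continuousAt.2 fun t => (hint a t).continuousAt
      · intro a ha t
        rw [hdep a _ (γ t) fun b hb => if_pos (by omega)]
        by_cases hak : w a < k
        · simpa only [if_pos hak] using hγ a hak t
        · simpa only [if_neg hak] using hint a t
  obtain ⟨γ, hγ0, -, hγ⟩ := key (Finset.univ.sup w + 1)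
  exact ⟨γ, hγ0, fun t => hasDerivAt_pi.2 fun a =>
    hγ a (Nat.lt_succ_of_le (Finset.le_sup (Finset.mem_univ a))) t⟩

/-- a vector field `X = (f₁, …, fₙ)` on `ℝⁿ` whose component `fₐ` vanishes
when `wₐ = 0`, and is a finite sum `∑_s g_{a,s}(x⁰)·x^s` over multi-indices `s` supported
on the positive-weight coordinates with `w·s < wₐ` when `wₐ ≥ 1` (each `g_{a,s}` a smooth
function of the weight-zero coordinates `x⁰`), is complete. -/
theorem vectorField_complete (n : ℕ) (w : Fin n → ℕ)
    (f : Fin n → (Fin n → ℝ) → ℝ)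
    (h0 : ∀ a, w a = 0 → f a = 0)
    (h1 : ∀ a, 1 ≤ w a →
      ∃ (S : Finset (Fin n → ℕ)) (g : (Fin n → ℕ) → (Fin n → ℝ) → ℝ),
        (∀ s ∈ S, (∀ b, w b = 0 → s b = 0) ∧ (∑ b, w b * s b) < w a) ∧
        (∀ s ∈ S, ContDiff ℝ (⊤ : ℕ∞) (g s) ∧
          ∀ x y : Fin n → ℝ, (∀ b, w b = 0 → x b = y b) → g s x = g s y) ∧
        (∀ x : Fin n → ℝ, f a x = ∑ s ∈ S, g s x * ∏ b, x b ^ s b)) :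
    ∀ x₀ : Fin n → ℝ, ∃ γ : ℝ → (Fin n → ℝ),
      γ 0 = x₀ ∧ ∀ t : ℝ, HasDerivAt γ (fun a => f a (γ t)) t := by
  refine exists_integralCurve_of_triangular w f (fun a => ?_) fun a x y hxy => ?_
  · rcases Nat.eq_zero_or_pos (w a) with ha | ha
    · rw [h0 a ha]
      exact continuous_const
    · obtain ⟨S, g, -, hg, hfa⟩ := h1 a ha
      rw [funext hfa]
      exact continuous_finsetSum _ fun s hs => (hg s hs).1.continuous.mul (by fun_prop)
  · rcases Nat.eq_zero_or_pos (w a) with ha | ha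
    · simp [h0 a ha]
    · obtain ⟨S, g, hS, hg, hfa⟩ := h1 a ha
      rw [hfa, hfa]
      refine Finset.sum_congr rfl fun s hs => ?_
      rw [(hg s hs).2 x y fun b hb => hxy b (hb ▸ ha)]
      congr 1
      refine Finset.prod_congr rfl fun b _ => ?_
      rcases Nat.eq_zero_or_pos (s b) with hsb | hsb
      · simp [hsb]
      · have hle : w b * s b ≤ ∑ c, w c * s c :=
          Finset.single_le_sum (f := fun c => w c * s c) (fun _ _ => Nat.zero_le _)
            (Finset.mem_univ b)
        rw [hxy b ((Nat.le_mul_of_pos_right _ hsb).trans_lt (hle.trans_lt (hS s hs).2))]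
end

section
/- Let f : ℝⁿ → ℝ be smooth and not identically zero, and let k ∈ ℝ. Suppose f(κ_t x) = t^k·f(x) for all real t > 0 and all x ∈ ℝⁿ. Then k is a nonnegative integer, and f is a finite sum f(x) = ∑_s g_s(x⁰)·x^s over multi-indices s supported on the positive-weight coordinates with w·s = k, where x⁰ denotes the tuple of weight-zero coordinates of x and each g_s is a smooth function of x⁰. -/
open scoped BigOperators

/-- The weighted scaling `κ_t` on `ℝⁿ`: `(κ_t x)_a = t^{w_a} · x_a`. -/
def kappa (n : ℕ) (w : Fin n → ℕ) (t : ℝ) (x : Fin n → ℝ) : Fin n → ℝ :=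
  fun a => t ^ w a * x a

/-- `f` is weighted homogeneous of degree `k` under the scalings `kappa n w t`, `t > 0`. -/
def IsKappaHomogeneous {n : ℕ} (w : Fin n → ℕ) (k : ℝ) (f : (Fin n → ℝ) → ℝ) : Prop :=
  ∀ t : ℝ, 0 < t → ∀ x : Fin n → ℝ, f (kappa n w t x) = Real.rpow t k * f x

/-- `f` is a finite sum of monomials of weight `k` in the positive-weight coordinates, whose
coefficients are smooth functions of the weight-zero coordinates. -/
def IsWeightedPolynomial {n : ℕ} (w : Fin n → ℕ) (k : ℝ) (f : (Fin n → ℝ) → ℝ) : Prop :=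
  ∃ g : (Fin n → ℕ) →₀ ((Fin n → ℝ) → ℝ),
    (∀ s, g s ≠ 0 → (∀ b, w b = 0 → s b = 0) ∧ ((∑ b, w b * s b : ℕ) : ℝ) = k) ∧
    (∀ s, ContDiff ℝ (⊤ : ℕ∞) (g s) ∧
      ∀ x y : Fin n → ℝ, (∀ b, w b = 0 → x b = y b) → g s x = g s y) ∧
    ∀ x, f x = g.sum fun s h => h x * ∏ b, x b ^ s b

namespace IsWeightedPolynomial

variable {n : ℕ} {w : Fin n → ℕ} {k : ℝ}

theorem zero : IsWeightedPolynomial w k (fun _ => 0) :=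
  ⟨0, by simp, fun s => ⟨contDiff_const, by simp⟩, by simp⟩

theorem add {f₁ f₂ : (Fin n → ℝ) → ℝ} (h₁ : IsWeightedPolynomial w k f₁)
    (h₂ : IsWeightedPolynomial w k f₂) : IsWeightedPolynomial w k (fun x => f₁ x + f₂ x) := by
  obtain ⟨g₁, hs₁, hg₁, hf₁⟩ := h₁
  obtain ⟨g₂, hs₂, hg₂, hf₂⟩ := h₂
  refine ⟨g₁ + g₂, fun s hs => ?_, fun s => ⟨?_, fun x y hxy => ?_⟩, fun x => ?_⟩
  · by_cases h : g₁ s = 0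
    · exact hs₂ s (by simpa [h] using hs)
    · exact hs₁ s h
  · exact (hg₁ s).1.add (hg₂ s).1
  · simp [(hg₁ s).2 x y hxy, (hg₂ s).2 x y hxy]
  · rw [Finsupp.sum_add_index' (by simp) (by intros; simp [add_mul]), ← hf₁, ← hf₂]

theorem sum {ι : Type*} (S : Finset ι) {F : ι → (Fin n → ℝ) → ℝ}
    (h : ∀ i ∈ S, IsWeightedPolynomial w k (F i)) :
    IsWeightedPolynomial w k (fun x => ∑ i ∈ S, F i x) := by
  classical
  induction S using Finset.induction_on with
  | empty => simpa using zero
  | insert i S hi ih =>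
    simp only [Finset.sum_insert hi]
    exact (h i (Finset.mem_insert_self i S)).add
      (ih fun j hj => h j (Finset.mem_insert_of_mem hj))

theorem monomial (s : Fin n → ℕ) (hs : ∀ b, w b = 0 → s b = 0)
    (hk : ((∑ b, w b * s b : ℕ) : ℝ) = k) {h : (Fin n → ℝ) → ℝ} (hh : ContDiff ℝ (⊤ : ℕ∞) h)
    (hh₀ : ∀ x y : Fin n → ℝ, (∀ b, w b = 0 → x b = y b) → h x = h y) :
    IsWeightedPolynomial w k (fun x => h x * ∏ b, x b ^ s b) := by
  classical
  refine ⟨Finsupp.single s h, fun s' hs' => ?_, fun s' => ?_, fun x => ?_⟩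
  · obtain rfl : s = s' := by
      by_contra hne
      exact hs' (by simp [hne])
    exact ⟨hs, hk⟩
  · by_cases hss : s = s'
    · subst hss
      simpa using ⟨hh, hh₀⟩
    · rw [Finsupp.single_eq_of_ne (Ne.symm hss)]
      exact ⟨contDiff_const, by simp⟩
  · rw [Finsupp.sum_single_index (by simp)]

/-- Multiplication by a positive-weight coordinate raises the weight by that of the coordinate. -/
theorem coord_mul {f : (Fin n → ℝ) → ℝ} {a : Fin n} (ha : w a ≠ 0)
    (hf : IsWeightedPolynomial w (k - w a) f) (c : ℝ) :
    IsWeightedPolynomial w k (fun x => c * x a * f x) := by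
  obtain ⟨g, hs, hg, hf⟩ := hf
  have heq : (fun x => c * x a * f x) = fun x => ∑ s ∈ g.support,
      c * g s x * ∏ b, x b ^ (s + Pi.single a 1 : Fin n → ℕ) b := by
    funext x
    rw [hf x, Finsupp.sum, Finset.mul_sum]
    refine Finset.sum_congr rfl fun s _ => ?_
    have hprod : ∏ b, x b ^ (Pi.single a 1 : Fin n → ℕ) b = x a := by
      rw [Finset.prod_eq_single a (fun b _ hb => by simp [hb]) (by simp)]
      simp
    simp only [Pi.add_apply, pow_add, Finset.prod_mul_distrib, hprod]
    ring
  rw [heq]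
  refine sum _ fun s hsg => ?_
  obtain ⟨hs₀, hsk⟩ := hs s (Finsupp.mem_support_iff.mp hsg)
  refine monomial (s + Pi.single a 1) (fun b hb => ?_) ?_ (contDiff_const.mul (hg s).1)
    fun x y hxy => by rw [(hg s).2 x y hxy]
  · have hba : b ≠ a := by
      rintro rfl
      exact ha hb
    simp [hs₀ b hb, hba]
  · have hsum : ∑ b, w b * (s + Pi.single a 1 : Fin n → ℕ) b = ∑ b, w b * s b + w a := by
      simp [mul_add, Finset.sum_add_distrib, Pi.single_apply]
    rw [hsum, Nat.cast_add, hsk]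
    ring

end IsWeightedPolynomial

namespace IsKappaHomogeneous

variable {n : ℕ} {w : Fin n → ℕ} {k : ℝ} {f : (Fin n → ℝ) → ℝ}

theorem fderiv_single (hf : ContDiff ℝ (⊤ : ℕ∞) f) (hhom : IsKappaHomogeneous w k f)
    (a : Fin n) : IsKappaHomogeneous w (k - w a) fun x => fderiv ℝ f x (Pi.single a 1) := by
  intro t ht x
  have hd : Differentiable ℝ f := hf.differentiable (by simp)
  have hline : HasDerivAt (fun r : ℝ => x + r • (Pi.single a 1 : Fin n → ℝ))
      (Pi.single a 1) 0 := by
    simpa using ((hasDerivAt_id (0 : ℝ)).smul_const (Pi.single a 1 : Fin n → ℝ)).const_add x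
  have hscaled : HasDerivAt (fun r : ℝ => kappa n w t (x + r • (Pi.single a 1 : Fin n → ℝ)))
      (t ^ w a • Pi.single a 1) 0 := by
    have h := ((hasDerivAt_id (0 : ℝ)).smul_const
      (t ^ w a • Pi.single a 1 : Fin n → ℝ)).const_add (kappa n w t x)
    rw [one_smul] at h
    refine h.congr_of_eventuallyEq (.of_forall fun r => ?_)
    funext b
    by_cases hb : b = a
    · subst hb
      simp [kappa]
      ring
    · simp [kappa, hb]
  have hleft : HasDerivAt (fun r : ℝ => f (kappa n w t (x + r • (Pi.single a 1 : Fin n → ℝ))))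
      (fderiv ℝ f (kappa n w t x) (t ^ w a • Pi.single a 1)) 0 := by
    refine HasFDerivAt.comp_hasDerivAt (0 : ℝ) ?_ hscaled
    simpa using (hd (kappa n w t x)).hasFDerivAt
  have hright : HasDerivAt (fun r : ℝ => f (x + r • (Pi.single a 1 : Fin n → ℝ)))
      (fderiv ℝ f x (Pi.single a 1)) 0 := by
    refine HasFDerivAt.comp_hasDerivAt (0 : ℝ) ?_ hline
    simpa using (hd x).hasFDerivAt
  have hpow : Real.rpow t k = t ^ w a * Real.rpow t (k - w a) := by
    simp only [Real.rpow_eq_pow]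
    rw [Real.rpow_sub ht, Real.rpow_natCast]
    field_simp
  simp only [hhom t ht] at hleft
  have h := hleft.unique (hright.const_mul _)
  rw [map_smul, smul_eq_mul, hpow, mul_assoc] at h
  exact mul_left_cancel₀ (pow_pos ht _).ne' h

/-- Euler's identity for weighted homogeneous functions. -/
theorem euler (hf : ContDiff ℝ (⊤ : ℕ∞) f) (hhom : IsKappaHomogeneous w k f)
    (x : Fin n → ℝ) : k * f x = ∑ a, w a * x a * fderiv ℝ f x (Pi.single a 1) := by
  have hd : Differentiable ℝ f := hf.differentiable (by simp)
  have hcurve : HasDerivAt (fun t : ℝ => kappa n w t x) (fun a => w a * x a) 1 := by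
    rw [hasDerivAt_pi]
    intro a
    simpa [kappa] using (hasDerivAt_pow (w a) (1 : ℝ)).mul_const (x a)
  have hleft : HasDerivAt (fun t : ℝ => f (kappa n w t x))
      (fderiv ℝ f x (fun a => w a * x a)) 1 := by
    refine HasFDerivAt.comp_hasDerivAt (1 : ℝ) ?_ hcurve
    have hone : kappa n w 1 x = x := by
      funext b
      simp [kappa]
    rw [hone]
    exact (hd x).hasFDerivAt
  have hright : HasDerivAt (fun t : ℝ => f (kappa n w t x)) (k * f x) 1 := by
    have h := (Real.hasDerivAt_rpow_const (x := 1) (p := k) (Or.inl one_ne_zero)).mul_const (f x)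
    rw [Real.one_rpow, mul_one] at h
    refine h.congr_of_eventuallyEq ?_
    filter_upwards [lt_mem_nhds (zero_lt_one (α := ℝ))] with t ht
    exact hhom t ht x
  rw [← hleft.unique hright, pi_eq_sum_univ' (fun a => (w a : ℝ) * x a), map_sum]
  refine Finset.sum_congr rfl fun a _ => ?_
  rw [map_smul, smul_eq_mul]

theorem isWeightedPolynomial_of_nonpos (hf : ContDiff ℝ (⊤ : ℕ∞) f)
    (hhom : IsKappaHomogeneous w k f) (hk : k ≤ 0) : IsWeightedPolynomial w k f := by
  have hlim (x : Fin n → ℝ) : f x = Real.rpow 0 (-k) * f (kappa n w 0 x) := by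
    have hcont : Continuous fun t : ℝ => Real.rpow t (-k) * f (kappa n w t x) := by
      refine (Real.continuous_rpow_const (neg_nonneg.mpr hk)).mul (hf.continuous.comp ?_)
      unfold kappa
      fun_prop
    refine tendsto_nhds_unique (Filter.Tendsto.congr' ?_ tendsto_const_nhds)
      ((hcont.tendsto 0).mono_left (nhdsWithin_le_nhds (s := Set.Ioi 0)))
    filter_upwards [self_mem_nhdsWithin] with t ht
    have ht : 0 < t := ht
    rw [hhom t ht x, ← mul_assoc]
    simp only [Real.rpow_eq_pow]
    rw [← Real.rpow_add ht]
    simp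
  rcases hk.lt_or_eq with hk | rfl
  · have hzero : f = fun _ => 0 := by
      funext x
      rw [hlim x, Real.rpow_eq_pow, Real.zero_rpow (neg_pos.mpr hk).ne', zero_mul]
    rw [hzero]
    exact .zero
  · have hmono := IsWeightedPolynomial.monomial (w := w) (k := 0) (0 : Fin n → ℕ) (by simp)
      (by simp) hf fun x y hxy => by
        rw [hlim x, hlim y]
        congr 2
        funext b
        by_cases hb : w b = 0
        · simp [kappa, hxy b hb]
        · simp [kappa, hb]
    simpa using hmono

theorem isWeightedPolynomial (hf : ContDiff ℝ (⊤ : ℕ∞) f) (hhom : IsKappaHomogeneous w k f) :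
    IsWeightedPolynomial w k f := by
  obtain ⟨N, hN⟩ := exists_nat_ge k
  induction N generalizing k f with
  | zero => exact isWeightedPolynomial_of_nonpos hf hhom (by simpa using hN)
  | succ N ih =>
    rcases le_or_gt k 0 with hk | hk
    · exact isWeightedPolynomial_of_nonpos hf hhom hk
    have heq : f = fun x => ∑ a, w a / k * x a * fderiv ℝ f x (Pi.single a 1) := by
      funext x
      rw [← mul_right_inj' hk.ne', euler hf hhom x, Finset.mul_sum]
      refine Finset.sum_congr rfl fun a _ => ?_
      field_simp
    rw [heq]
    refine .sum _ fun a _ => ?_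
    by_cases ha : w a = 0
    · simpa [ha] using IsWeightedPolynomial.zero
    refine .coord_mul ha (ih ?_ (hhom.fderiv_single hf a) ?_) _
    · exact (hf.fderiv_right (by simp)).clm_apply contDiff_const
    · have hw : (1 : ℝ) ≤ w a := by exact_mod_cast Nat.one_le_iff_ne_zero.mpr ha
      push_cast at hN
      linarith

end IsKappaHomogeneous

/-- a smooth, not identically zero function `f` on `ℝⁿ` satisfying
`f(κ_t x) = t^k·f(x)` for all `t > 0` has `k` a nonnegative integer, and `f` is a finite
sum `∑_s g_s(x⁰)·x^s` over multi-indices `s` supported on the positive-weight coordinates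
with `w·s = k`, each `g_s` being a smooth function of the weight-zero coordinates `x⁰`. -/
theorem homogeneous_smooth_function_structure (n : ℕ) (w : Fin n → ℕ)
    (f : (Fin n → ℝ) → ℝ) (hf : ContDiff ℝ (⊤ : ℕ∞) f) (hne : f ≠ 0) (k : ℝ)
    (hhom : ∀ t : ℝ, 0 < t → ∀ x : Fin n → ℝ, f (kappa n w t x) = Real.rpow t k * f x) :
    ∃ m : ℕ, (m : ℝ) = k ∧
      ∃ (S : Finset (Fin n → ℕ)) (g : (Fin n → ℕ) → (Fin n → ℝ) → ℝ),
        (∀ s ∈ S, (∀ b, w b = 0 → s b = 0) ∧ (∑ b, w b * s b) = m) ∧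
        (∀ s ∈ S, ContDiff ℝ (⊤ : ℕ∞) (g s) ∧
          ∀ x y : Fin n → ℝ, (∀ b, w b = 0 → x b = y b) → g s x = g s y) ∧
        (∀ x : Fin n → ℝ, f x = ∑ s ∈ S, g s x * ∏ b, x b ^ s b) := by
  obtain ⟨g, hs, hg, hfg⟩ := IsKappaHomogeneous.isWeightedPolynomial hf hhom
  have hg₀ : g ≠ 0 := by
    rintro rfl
    exact hne (funext fun x => by simp [hfg x])
  obtain ⟨s₀, hs₀⟩ := Finsupp.ne_iff.mp hg₀
  refine ⟨∑ b, w b * s₀ b, (hs s₀ hs₀).2, g.support, g, fun s hsg => ?_, fun s _ => hg s, hfg⟩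
  have h := hs s (Finsupp.mem_support_iff.mp hsg)
  exact ⟨h.1, by exact_mod_cast h.2.trans (hs s₀ hs₀).2.symm⟩
end

section
/- Let U = {(y,t) ∈ ℝⁿ × ℝ : y_a ≠ 0 for some index a with w_a ≥ 1}, an open subset of ℝⁿ × ℝ. The multiplicative group ℝ_{>0} of positive real numbers acts on U by u·(y,t) = (κ_u y, u⁻¹·t). This action is well defined (each u·(y,t) again lies in U), continuous, free (u·p = p for some p ∈ U implies u = 1), and proper: the map ℝ_{>0} × U → U × U sending (u,p) to (u·p, p) is a proper map, i.e. preimages of compact sets are compact. -/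
/-- The action `u·(y,t) = (κ_u y, u⁻¹·t)` of positive scalars on `ℝⁿ × ℝ`. -/
noncomputable def scalingAction (n : ℕ) (w : Fin n → ℕ) (u : ℝ) (p : (Fin n → ℝ) × ℝ) :
    (Fin n → ℝ) × ℝ :=
  (kappa n w u p.1, u⁻¹ * p.2)

/-- The quasi-norm `∑ |y_a| ^ (1 / w_a)` over the indices `a` of positive weight. -/
noncomputable def weightedQuasiNorm (n : ℕ) (w : Fin n → ℕ) (y : Fin n → ℝ) : ℝ :=
  ∑ a with 1 ≤ w a, |y a| ^ ((w a : ℝ)⁻¹)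

theorem continuous_weightedQuasiNorm (n : ℕ) (w : Fin n → ℕ) :
    Continuous (weightedQuasiNorm n w) := by
  unfold weightedQuasiNorm
  refine continuous_finsetSum _ fun a _ => ?_
  exact (continuous_apply a).abs.rpow_const fun _ => Or.inr (by positivity)

theorem weightedQuasiNorm_kappa (n : ℕ) (w : Fin n → ℕ) {u : ℝ} (hu : 0 ≤ u)
    (y : Fin n → ℝ) :
    weightedQuasiNorm n w (kappa n w u y) = u * weightedQuasiNorm n w y := by
  unfold weightedQuasiNorm kappa
  rw [Finset.mul_sum]
  refine Finset.sum_congr rfl fun a ha => ?_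
  have hw : w a ≠ 0 := Nat.one_le_iff_ne_zero.mp (Finset.mem_filter.mp ha).2
  rw [abs_mul, abs_of_nonneg (pow_nonneg hu _),
    Real.mul_rpow (pow_nonneg hu _) (abs_nonneg _), Real.pow_rpow_inv_natCast hu hw]

theorem weightedQuasiNorm_pos {n : ℕ} {w : Fin n → ℕ} {y : Fin n → ℝ}
    (hy : ∃ a, 1 ≤ w a ∧ y a ≠ 0) : 0 < weightedQuasiNorm n w y := by
  obtain ⟨a, hwa, hya⟩ := hy
  exact Finset.sum_pos' (fun b _ => Real.rpow_nonneg (abs_nonneg _) _)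
    ⟨a, by simpa using hwa, Real.rpow_pos_of_pos (abs_pos.mpr hya) _⟩

theorem continuousOn_scalingAction (n : ℕ) (w : Fin n → ℕ) :
    ContinuousOn (fun q : ℝ × ((Fin n → ℝ) × ℝ) => scalingAction n w q.1 q.2)
      {q | q.1 ≠ 0} := by
  unfold scalingAction kappa
  refine ContinuousOn.prodMk (Continuous.continuousOn (by fun_prop)) ?_
  exact (continuousOn_fst.inv₀ fun _ hq => hq).mul (by fun_prop)

theorem IsCompact.setOf_eq_of_continuousOn {X Y : Type*} [TopologicalSpace X]
    [TopologicalSpace Y] [T2Space Y] {K : Set X} {f g : X → Y} (hK : IsCompact K)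
    (hf : ContinuousOn f K) (hg : ContinuousOn g K) : IsCompact {x ∈ K | f x = g x} := by
  have : CompactSpace K := isCompact_iff_compactSpace.mp hK
  have h : IsClosed {x : K | f x = g x} :=
    isClosed_eq (continuousOn_iff_continuous_domRestrict.mp hf)
      (continuousOn_iff_continuous_domRestrict.mp hg)
  convert h.isCompact.image continuous_subtype_val using 1
  ext x
  simp [and_comm]

/-- on the open set `U = {(y,t) | y_a ≠ 0 for some a with w_a ≥ 1}`, the
action `u·(y,t) = (κ_u y, u⁻¹ t)` of `ℝ_{>0}` is well defined, continuous, free, and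
proper. -/
theorem scalingAction_isOpen_continuous_free_proper (n : ℕ) (w : Fin n → ℕ) :
    IsOpen {p : (Fin n → ℝ) × ℝ | ∃ a, 1 ≤ w a ∧ p.1 a ≠ 0} ∧
    (∀ u : ℝ, 0 < u → ∀ p ∈ {p : (Fin n → ℝ) × ℝ | ∃ a, 1 ≤ w a ∧ p.1 a ≠ 0},
      scalingAction n w u p ∈ {p : (Fin n → ℝ) × ℝ | ∃ a, 1 ≤ w a ∧ p.1 a ≠ 0}) ∧
    ContinuousOn (fun q : ℝ × ((Fin n → ℝ) × ℝ) => scalingAction n w q.1 q.2)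
      (Set.Ioi (0 : ℝ) ×ˢ {p : (Fin n → ℝ) × ℝ | ∃ a, 1 ≤ w a ∧ p.1 a ≠ 0}) ∧
    (∀ u : ℝ, 0 < u → ∀ p ∈ {p : (Fin n → ℝ) × ℝ | ∃ a, 1 ≤ w a ∧ p.1 a ≠ 0},
      scalingAction n w u p = p → u = 1) ∧
    (∀ K : Set (((Fin n → ℝ) × ℝ) × ((Fin n → ℝ) × ℝ)), IsCompact K →
      K ⊆ {p : (Fin n → ℝ) × ℝ | ∃ a, 1 ≤ w a ∧ p.1 a ≠ 0} ×ˢ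
        {p : (Fin n → ℝ) × ℝ | ∃ a, 1 ≤ w a ∧ p.1 a ≠ 0} →
      IsCompact {q : ℝ × ((Fin n → ℝ) × ℝ) | q.1 ∈ Set.Ioi (0 : ℝ) ∧
        q.2 ∈ {p : (Fin n → ℝ) × ℝ | ∃ a, 1 ≤ w a ∧ p.1 a ≠ 0} ∧
        (scalingAction n w q.1 q.2, q.2) ∈ K}) := by
  refine ⟨?_, ?_, ?_, ?_, ?_⟩
  · simp only [Set.ofPred_exists, Set.ofPred_and]
    refine isOpen_iUnion fun a => isOpen_const.inter ?_
    exact isOpen_ne_fun (by fun_prop) continuous_const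
  · rintro u hu p ⟨a, hwa, hpa⟩
    exact ⟨a, hwa, mul_ne_zero (pow_ne_zero _ hu.ne') hpa⟩
  · exact (continuousOn_scalingAction n w).mono fun q hq => (Set.mem_Ioi.mp hq.1).ne'
  · intro u hu p hp h
    have h' := weightedQuasiNorm_kappa n w hu.le p.1
    rw [show kappa n w u p.1 = p.1 from congrArg Prod.fst h] at h'
    exact (right_eq_mul₀ (weightedQuasiNorm_pos hp).ne').mp h'
  · intro K hK hKU
    let r : ((Fin n → ℝ) × ℝ) × ((Fin n → ℝ) × ℝ) → ℝ := fun z =>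
      weightedQuasiNorm n w z.1.1 / weightedQuasiNorm n w z.2.1
    have hr_pos : ∀ z ∈ K, 0 < r z := fun z hz =>
      div_pos (weightedQuasiNorm_pos (hKU hz).1) (weightedQuasiNorm_pos (hKU hz).2)
    have hN := continuous_weightedQuasiNorm n w
    have hr : ContinuousOn r K :=
      ContinuousOn.div (Continuous.continuousOn (by fun_prop))
        (Continuous.continuousOn (by fun_prop))
        fun z hz => (weightedQuasiNorm_pos (hKU hz).2).ne'
    have hg : ContinuousOn (fun z => (r z, z.2)) K := hr.prodMk continuousOn_snd
    have hact : ContinuousOn (fun z => scalingAction n w (r z) z.2) K :=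
      (continuousOn_scalingAction n w).comp hg fun z hz => (hr_pos z hz).ne'
    convert (hK.setOf_eq_of_continuousOn hact continuousOn_fst).image_of_continuousOn
      (hg.mono fun z hz => hz.1) using 1
    ext ⟨u, p⟩
    constructor
    · rintro ⟨hu, hp, hK'⟩
      have hru : r (scalingAction n w u p, p) = u := by
        change weightedQuasiNorm n w (kappa n w u p.1) / weightedQuasiNorm n w p.1 = u
        rw [weightedQuasiNorm_kappa n w (le_of_lt hu),
          mul_div_cancel_right₀ _ (weightedQuasiNorm_pos hp).ne']
      exact ⟨(scalingAction n w u p, p), ⟨hK', by simp only [hru]⟩, by simp only [hru]⟩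
    · rintro ⟨⟨x, p'⟩, ⟨hz, hx⟩, h⟩
      obtain ⟨rfl, rfl⟩ := Prod.mk.inj h
      refine ⟨hr_pos _ hz, (hKU hz).2, ?_⟩
      simp only at hx ⊢
      rwa [hx]
end

section
/- Let V be a finite-dimensional real vector space and let ρ : ℝ → (V →ₗ[ℝ] V) be a map which is smooth (as a map into the finite-dimensional space of linear endomorphisms of V) and satisfies ρ(1) = id_V and ρ(s·t) = ρ(s) ∘ ρ(t) for all s, t ∈ ℝ. Then there exist m ∈ ℕ and linear subspaces V₀, V₁, …, V_m of V with V = V₀ ⊕ V₁ ⊕ ⋯ ⊕ V_m such that for every i with 0 ≤ i ≤ m, every v ∈ V_i, and every t ∈ ℝ, one has ρ(t)(v) = t^i·v. -/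
/-- The Taylor coefficients at `0` of a smooth multiplicative map are eigenvectors for left
multiplication by its values. -/
theorem MonoidHom.mul_iteratedDeriv_zero {A : Type*} [NormedRing A] [NormedAlgebra ℝ A]
    (R : ℝ →* A) (hR : ContDiff ℝ (⊤ : ℕ∞) R) (n : ℕ) (t : ℝ) :
    R t * iteratedDeriv n R 0 = t ^ n • iteratedDeriv n R 0 := by
  have hn : ContDiff ℝ n R := hR.of_le (by exact_mod_cast le_top)
  have h := congrFun (iteratedDeriv_comp_const_smul hn t) 0
  simp only [map_mul, mul_zero] at h
  rw [← h, iteratedDeriv_const_mul _ hn.contDiffAt]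

open Filter Topology Nat in
/-- A smooth multiplicative map has finitely many Taylor coefficients at `0` that sum to `1`. -/
theorem MonoidHom.exists_sum_iteratedDeriv_zero_eq_one {A : Type*} [NormedRing A]
    [NormedAlgebra ℝ A] (R : ℝ →* A) (hR : ContDiff ℝ (⊤ : ℕ∞) R) :
    ∃ m : ℕ, ∑ n ∈ Finset.range (m + 1), (n ! : ℝ)⁻¹ • iteratedDeriv n R 0 = 1 := by
  obtain ⟨m, hm⟩ := pow_unbounded_of_one_lt ‖R 2‖ (one_lt_two : (1 : ℝ) < 2)
  refine ⟨m, ?_⟩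
  set S := ∑ n ∈ Finset.range (m + 1), (n ! : ℝ)⁻¹ • iteratedDeriv n R 0 with hS
  have hn : ContDiff ℝ m R := hR.of_le (by exact_mod_cast le_top)
  have hpow : Tendsto (fun k : ℕ => (2⁻¹ : ℝ) ^ k) atTop (𝓝 0) :=
    tendsto_pow_atTop_nhds_zero_of_lt_one (by norm_num) (by norm_num)
  have hTaylor := hpow.eventually ((taylor_isLittleO_univ (x₀ := 0) hn).bound one_pos)
  have hfactor (k : ℕ) : R 2 ^ k *
      (R (2⁻¹ ^ k) - taylorWithinEval R m Set.univ 0 (2⁻¹ ^ k)) = 1 - S := by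
    have hinv : (2 : ℝ) ^ k * 2⁻¹ ^ k = 1 := by rw [← mul_pow]; norm_num
    rw [← map_pow, mul_sub, ← map_mul, hinv, map_one, taylor_within_apply, Finset.mul_sum, hS]
    congr 1
    refine Finset.sum_congr rfl fun n _ => ?_
    rw [iteratedDerivWithin_univ, mul_smul_comm, R.mul_iteratedDeriv_zero hR, smul_smul,
      sub_zero, mul_assoc, ← mul_pow, mul_comm _ ((2 : ℝ) ^ k), hinv, one_pow, mul_one]
  have hbound : ∀ᶠ k : ℕ in atTop, ‖1 - S‖ ≤ (‖R 2‖ / 2 ^ m) ^ k := by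
    filter_upwards [hTaylor, eventually_gt_atTop 0] with k hk hk0
    rw [← hfactor k]
    refine (norm_mul_le_of_le (norm_pow_le' _ hk0) hk).trans_eq ?_
    rw [sub_zero, one_mul, Real.norm_of_nonneg (by positivity), pow_right_comm, ← mul_pow,
      inv_pow, div_eq_mul_inv]
  have hlim : Tendsto (fun k : ℕ => (‖R 2‖ / 2 ^ m) ^ k) atTop (𝓝 0) :=
    tendsto_pow_atTop_nhds_zero_of_lt_one (by positivity) ((div_lt_one (by positivity)).2 hm)
  have hzero : ‖1 - S‖ ≤ 0 := ge_of_tendsto hlim hbound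
  exact (sub_eq_zero.1 (norm_le_zero_iff.1 hzero)).symm


/-- a smooth multiplicative action `ρ` of the monoid `(ℝ,·)` on a
finite-dimensional real vector space `V` decomposes `V` into a direct sum of subspaces
`V₀ ⊕ ⋯ ⊕ V_m` on which `ρ(t)` acts as multiplication by `tⁱ`. -/
theorem smooth_monoid_action_decomposition
    (V : Type*) [NormedAddCommGroup V] [NormedSpace ℝ V] [FiniteDimensional ℝ V]
    (ρ : ℝ → (V →ₗ[ℝ] V))
    (hsmooth : ContDiff ℝ (⊤ : ℕ∞) fun t => LinearMap.toContinuousLinearMap (ρ t))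
    (hone : ρ 1 = LinearMap.id)
    (hmul : ∀ s t : ℝ, ρ (s * t) = (ρ s).comp (ρ t)) :
    ∃ (m : ℕ) (Vsub : Fin (m + 1) → Submodule ℝ V),
      DirectSum.IsInternal Vsub ∧
      ∀ (i : Fin (m + 1)) (v : V), v ∈ Vsub i → ∀ t : ℝ, ρ t v = t ^ (i : ℕ) • v := by
  let R : ℝ →* (V →L[ℝ] V) :=
    { toFun t := LinearMap.toContinuousLinearMap (ρ t)
      map_one' := by ext v; simp [hone]
      map_mul' s t := by ext v; simp [hmul] }
  have hR : ContDiff ℝ (⊤ : ℕ∞) R := hsmooth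
  obtain ⟨m, hm⟩ := R.exists_sum_iteratedDeriv_zero_eq_one hR
  let W (i : Fin (m + 1)) : Submodule ℝ V := (iteratedDeriv i R 0).range
  have hW (i : Fin (m + 1)) (v : V) (hv : v ∈ W i) (t : ℝ) : ρ t v = t ^ (i : ℕ) • v := by
    obtain ⟨w, rfl⟩ := hv
    exact DFunLike.congr_fun (R.mul_iteratedDeriv_zero hR i t) w
  refine ⟨m, W, DirectSum.isInternal_submodule_of_iSupIndep_of_iSup_eq_top ?_ ?_, hW⟩
  · have hinj : Function.Injective fun i : Fin (m + 1) => (2 : ℝ) ^ (i : ℕ) := fun i j hij =>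
      Fin.ext (pow_right_injective₀ two_pos (by norm_num) hij)
    exact ((Module.End.eigenspaces_iSupIndep (ρ 2)).comp hinj).mono fun i v hv =>
      Module.End.mem_eigenspace_iff.2 (hW i v hv 2)
  · refine eq_top_iff.2 fun v _ => ?_
    have hv := DFunLike.congr_fun hm v
    rw [Finset.sum_range, sum_apply, one_apply_eq_self] at hv
    rw [← hv]
    exact Submodule.sum_mem _ fun i _ => Submodule.mem_iSup_of_mem i
      (Submodule.smul_mem _ _ ⟨v, rfl⟩)
end

section
/- Let u = (u₁,…,u_n) ∈ (A_r)ⁿ. Then the following are equivalent: (i) for every i with 1 ≤ i ≤ r, every polynomial f ∈ P_{(i)}, and every j with 0 ≤ j < i, one has coeff_j(ev_u(f)) = 0; (ii) for every index a and every j with 0 ≤ j < w_a, one has coeff_j(u_a) = 0. -/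
open scoped BigOperators

noncomputable section

/-- The truncated polynomial algebra `A_r = ℝ[X]/(X^{r+1})`. -/
abbrev Ar (r : ℕ) : Type :=
  AdjoinRoot ((Polynomial.X : Polynomial ℝ) ^ (r + 1))

/-- The class `ε` of `X` in `A_r`. -/
noncomputable def eps (r : ℕ) : Ar r :=
  AdjoinRoot.root _

/-- The `j`-th coefficient of an element of `A_r`, via the unique representative of
degree `≤ r`. -/
noncomputable def arCoeff (r j : ℕ) (a : Ar r) : ℝ :=
  (AdjoinRoot.modByMonicHom (Polynomial.monic_X_pow (R := ℝ) (r + 1)) a).coeff j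

/-- The ideal `P_{(i)}` of `ℝ[x₁,…,xₙ]` generated by the monomials `x^s` with `w·s ≥ i`. -/
noncomputable def weightedPolyIdeal (n : ℕ) (w : Fin n → ℕ) (i : ℕ) :
    Ideal (MvPolynomial (Fin n) ℝ) :=
  Ideal.span {p | ∃ s : Fin n → ℕ, i ≤ ∑ a, w a * s a ∧
    p = ∏ a, (MvPolynomial.X a : MvPolynomial (Fin n) ℝ) ^ s a}

theorem arCoeff_mk {r j : ℕ} (hj : j ≤ r) (p : Polynomial ℝ) :
    arCoeff r j (AdjoinRoot.mk _ p) = p.coeff j := by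
  rw [arCoeff, AdjoinRoot.modByMonicHom_mk]
  conv_rhs => rw [← Polynomial.modByMonic_add_div p (Polynomial.X ^ (r + 1))]
  rw [Polynomial.coeff_add, Polynomial.coeff_X_pow_mul', if_neg (by omega), add_zero]

theorem eps_pow_dvd_iff {r i : ℕ} (hi : i ≤ r + 1) (a : Ar r) :
    eps r ^ i ∣ a ↔ ∀ j < i, arCoeff r j a = 0 := by
  obtain ⟨p, rfl⟩ := AdjoinRoot.mk_surjective a
  have hmk : eps r ^ i = AdjoinRoot.mk _ (Polynomial.X ^ i) := by
    rw [map_pow, AdjoinRoot.mk_X, eps]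
  have hcoeff : (∀ j < i, arCoeff r j (AdjoinRoot.mk _ p) = 0) ↔ Polynomial.X ^ i ∣ p := by
    rw [Polynomial.X_pow_dvd_iff]
    refine forall₂_congr fun j hj => ?_
    rw [arCoeff_mk (by omega)]
  rw [hcoeff, hmk]
  refine ⟨?_, map_dvd _⟩
  rintro ⟨b, hb⟩
  obtain ⟨q, rfl⟩ := AdjoinRoot.mk_surjective b
  rw [← map_mul, AdjoinRoot.mk_eq_mk] at hb
  exact (dvd_sub_left (dvd_mul_right _ q)).mp ((pow_dvd_pow _ hi).trans hb)

theorem X_mem_weightedPolyIdeal {n : ℕ} (w : Fin n → ℕ) (a : Fin n) :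
    MvPolynomial.X a ∈ weightedPolyIdeal n w (w a) := by
  refine Ideal.subset_span ⟨Pi.single a 1, ?_, ?_⟩
  · simp [Pi.single_apply]
  · simp [Pi.single_apply, pow_ite]

theorem pow_dvd_aeval_of_mem_weightedPolyIdeal {n i : ℕ} {w : Fin n → ℕ} {A : Type*}
    [CommRing A] [Algebra ℝ A] {t : A} {u : Fin n → A} (hu : ∀ a, t ^ w a ∣ u a)
    {f : MvPolynomial (Fin n) ℝ} (hf : f ∈ weightedPolyIdeal n w i) :
    t ^ i ∣ MvPolynomial.aeval u f := by
  have hle : weightedPolyIdeal n w i ≤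
      (Ideal.span {t ^ i}).comap (MvPolynomial.aeval (R := ℝ) u) := by
    refine Ideal.span_le.mpr ?_
    rintro _ ⟨s, hs, rfl⟩
    rw [SetLike.mem_coe, Ideal.mem_comap, Ideal.mem_span_singleton]
    simp only [map_prod, map_pow, MvPolynomial.aeval_X]
    refine (pow_dvd_pow t hs).trans ?_
    rw [← Finset.prod_pow_eq_pow_sum]
    refine Finset.prod_dvd_prod_of_dvd _ _ fun a _ => ?_
    rw [pow_mul]
    exact pow_dvd_pow_of_dvd (hu a) (s a)
  exact Ideal.mem_span_singleton.mp (hle hf)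

/-- for `u ∈ (A_r)ⁿ`, the evaluations of all `f ∈ P_{(i)}` (for `1 ≤ i ≤ r`)
have vanishing coefficients in degrees `< i` if and only if each `u_a` has vanishing
coefficients in degrees `< w_a`. -/
theorem eval_weightedIdeal_coeff_vanish_iff (n r : ℕ) (hr : 1 ≤ r)
    (w : Fin n → ℕ) (hw : ∀ a, w a ≤ r) (u : Fin n → Ar r) :
    (∀ i : ℕ, 1 ≤ i → i ≤ r → ∀ f ∈ weightedPolyIdeal n w i,
        ∀ j : ℕ, j < i → arCoeff r j (MvPolynomial.aeval u f) = 0) ↔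
      (∀ a : Fin n, ∀ j : ℕ, j < w a → arCoeff r j (u a) = 0) := by
  constructor
  · intro h a j hj
    simpa using h (w a) (by omega) (hw a) _ (X_mem_weightedPolyIdeal w a) j hj
  · intro h i _ hir f hf
    refine (eps_pow_dvd_iff (by omega) _).mp (pow_dvd_aeval_of_mem_weightedPolyIdeal ?_ hf)
    exact fun a => (eps_pow_dvd_iff ((hw a).trans r.le_succ) _).mpr (h a)
end
end

section
/- Let r ≥ 1 and let B_r = ℝ[y₁,…,y_r]/(y₁²,…,y_r²), with the symmetric group S_r acting on B_r by ℝ-algebra automorphisms that permute the variables y₁,…,y_r. Then (y₁+⋯+y_r)^{r+1} = 0 in B_r, so there is a unique ℝ-algebra homomorphism Φ : A_r → B_r with Φ(ε) = y₁ + ⋯ + y_r; this homomorphism Φ is injective, and its image is exactly the subalgebra of S_r-invariant elements of B_r. -/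
open scoped BigOperators

noncomputable section

/-- The ideal `(y₁², …, y_r²)` of `ℝ[y₁,…,y_r]`. -/
noncomputable def sqIdeal (r : ℕ) : Ideal (MvPolynomial (Fin r) ℝ) :=
  Ideal.span (Set.range fun i : Fin r => (MvPolynomial.X i : MvPolynomial (Fin r) ℝ) ^ 2)

/-- The algebra `B_r = ℝ[y₁,…,y_r]/(y₁²,…,y_r²)`. -/
abbrev Br (r : ℕ) : Type :=
  MvPolynomial (Fin r) ℝ ⧸ sqIdeal r

/-- The class of the variable `y_i` in `B_r`. -/
noncomputable def yB (r : ℕ) (i : Fin r) : Br r :=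
  Ideal.Quotient.mk (sqIdeal r) (MvPolynomial.X i)

/-- The action of a permutation `σ ∈ S_r` on `B_r` by permuting the variables. -/
noncomputable def permAlgHom (r : ℕ) (σ : Equiv.Perm (Fin r)) : Br r →ₐ[ℝ] Br r :=
  Ideal.Quotient.liftₐ (sqIdeal r)
    ((Ideal.Quotient.mkₐ ℝ (sqIdeal r)).comp (MvPolynomial.rename σ)) (by
      intro p hp
      rw [AlgHom.comp_apply, Ideal.Quotient.mkₐ_eq_mk, Ideal.Quotient.eq_zero_iff_mem]
      have hmap : Ideal.map (MvPolynomial.rename (R := ℝ) ⇑σ).toRingHom (sqIdeal r) ≤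
          sqIdeal r := by
        rw [sqIdeal, Ideal.map_span]
        apply Ideal.span_le.mpr
        rintro q ⟨q', ⟨i, rfl⟩, rfl⟩
        simp only [AlgHom.toRingHom_eq_coe, RingHom.coe_coe, map_pow, MvPolynomial.rename_X]
        exact Ideal.subset_span ⟨σ i, rfl⟩
      exact hmap (Ideal.mem_map_of_mem _ hp))

/-- The exponent vector of the squarefree monomial `∏ i ∈ S, X i`. -/
def sqfreeExp {σ : Type*} (S : Finset σ) : σ →₀ ℕ :=
  ∑ i ∈ S, Finsupp.single i 1

lemma sqfreeExp_apply {σ : Type*} [DecidableEq σ] (S : Finset σ) (j : σ) :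
    sqfreeExp S j = if j ∈ S then 1 else 0 := by
  simp [sqfreeExp, Finsupp.finsetSum_apply, Finsupp.single_apply]

lemma mapDomain_sqfreeExp {σ τ : Type*} (f : σ ↪ τ) (S : Finset σ) :
    Finsupp.mapDomain f (sqfreeExp S) = sqfreeExp (S.map f) := by
  simp [sqfreeExp, Finsupp.mapDomain_finsetSum, Finsupp.mapDomain_single]

lemma sqfreeExp_sub_single {σ : Type*} [DecidableEq σ] (S : Finset σ) (i : σ) :
    sqfreeExp S - Finsupp.single i 1 = sqfreeExp (S.erase i) := by
  ext j
  rw [Finsupp.tsub_apply, sqfreeExp_apply, sqfreeExp_apply, Finsupp.single_apply]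
  simp only [Finset.mem_erase]
  grind

lemma mem_sqIdeal_iff {r : ℕ} (p : MvPolynomial (Fin r) ℝ) :
    p ∈ sqIdeal r ↔ ∀ S : Finset (Fin r), p.coeff (sqfreeExp S) = 0 := by
  have hspan : sqIdeal r = Ideal.span ((fun s => MvPolynomial.monomial s (1 : ℝ)) ''
      Set.range fun i : Fin r => Finsupp.single i 2) := by
    rw [sqIdeal, ← Set.range_comp]
    simp only [Function.comp_def, MvPolynomial.X_pow_eq_monomial]
  rw [hspan, MvPolynomial.mem_ideal_span_monomial_image]
  constructor
  · intro h S
    by_contra hS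
    obtain ⟨_, ⟨i, rfl⟩, hi⟩ := h _ (MvPolynomial.mem_support_iff.mpr hS)
    have h2 := hi i
    rw [Finsupp.single_eq_same, sqfreeExp_apply] at h2
    split_ifs at h2 <;> omega
  · intro h d hd
    by_contra! hlt
    refine MvPolynomial.mem_support_iff.mp hd ?_
    have hd' : d = sqfreeExp d.support := by
      ext j
      have hj : d j < 2 := by
        by_contra! hj
        exact hlt _ ⟨j, rfl⟩ (Finsupp.single_le_iff.mpr hj)
      rw [sqfreeExp_apply]
      simp only [Finsupp.mem_support_iff]
      split_ifs <;> omega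
    rw [hd', h]

lemma coeff_sqfreeExp_sum_X_pow {σ R : Type*} [Fintype σ] [CommSemiring R]
    (k : ℕ) (S : Finset σ) :
    ((∑ i : σ, MvPolynomial.X i : MvPolynomial σ R) ^ k).coeff (sqfreeExp S) =
      if S.card = k then (k.factorial : R) else 0 := by
  classical
  induction k generalizing S with
  | zero =>
    have h0 : (0 = sqfreeExp S) ↔ S.card = 0 := by
      rw [Finset.card_eq_zero]
      constructor
      · intro h
        ext j
        have hj := DFunLike.congr_fun h j
        rw [sqfreeExp_apply] at hj
        simp at hj
        simp [hj]
      · rintro rfl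
        simp [sqfreeExp]
    simp [MvPolynomial.coeff_one, h0]
  | succ k ih =>
    have hterm : ∀ i : σ,
        (MvPolynomial.X i * (∑ i : σ, MvPolynomial.X i : MvPolynomial σ R) ^ k).coeff
          (sqfreeExp S) = if i ∈ S then (if S.card = k + 1 then (k.factorial : R) else 0)
            else 0 := by
      intro i
      rw [MvPolynomial.coeff_X_mul', sqfreeExp_sub_single, ih]
      have hi : i ∈ (sqfreeExp S).support ↔ i ∈ S := by
        rw [Finsupp.mem_support_iff, sqfreeExp_apply]
        simp
      simp only [hi]
      split_ifs with h1 h2 h3 h3 <;> try rfl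
      all_goals
        have hc := Finset.card_erase_add_one h1
        omega
    rw [pow_succ', Finset.sum_mul, MvPolynomial.coeff_sum, Finset.sum_congr rfl fun i _ => hterm i,
      Finset.sum_ite_mem, Finset.univ_inter, Finset.sum_const, nsmul_eq_mul]
    split_ifs with h
    · rw [h, Nat.factorial_succ, Nat.cast_mul]
    · simp

lemma coeff_sqfreeExp_aeval_sum_X {σ R : Type*} [Fintype σ] [CommSemiring R]
    (q : Polynomial R) (S : Finset σ) :
    (Polynomial.aeval (∑ i : σ, MvPolynomial.X i : MvPolynomial σ R) q).coeff (sqfreeExp S) =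
      q.coeff S.card * (S.card.factorial : R) := by
  induction q using Polynomial.induction_on' with
  | add p q hp hq => simp [hp, hq, add_mul]
  | monomial n a =>
    rw [Polynomial.aeval_monomial, MvPolynomial.algebraMap_eq, MvPolynomial.coeff_C_mul,
      coeff_sqfreeExp_sum_X_pow, Polynomial.coeff_monomial]
    by_cases h : S.card = n
    · simp [h]
    · simp [h, Ne.symm h]

lemma exists_perm_map_eq {σ : Type*} [Fintype σ] {S T : Finset σ} (h : S.card = T.card) :
    ∃ e : Equiv.Perm σ, S.map e.toEmbedding = T := by
  classical
  let e : {x // x ∈ S} ≃ {x // x ∈ T} := Finset.equivOfCardEq h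
  refine ⟨e.extendSubtype, Finset.eq_of_subset_of_card_le ?_ (by simp [h])⟩
  intro x hx
  obtain ⟨y, hy, rfl⟩ := Finset.mem_map.mp hx
  exact e.extendSubtype_mem y hy

lemma permAlgHom_mk {r : ℕ} (σ : Equiv.Perm (Fin r)) (p : MvPolynomial (Fin r) ℝ) :
    permAlgHom r σ (Ideal.Quotient.mk (sqIdeal r) p) =
      Ideal.Quotient.mk (sqIdeal r) (MvPolynomial.rename σ p) :=
  rfl

lemma sum_yB (r : ℕ) :
    ∑ i : Fin r, yB r i = Ideal.Quotient.mk (sqIdeal r) (∑ i : Fin r, MvPolynomial.X i) := by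
  simp [yB]

lemma coeff_sqfreeExp_eq_of_invariant {r : ℕ} {p : MvPolynomial (Fin r) ℝ}
    (hp : ∀ σ, permAlgHom r σ (Ideal.Quotient.mk (sqIdeal r) p) = Ideal.Quotient.mk (sqIdeal r) p)
    {S T : Finset (Fin r)} (h : S.card = T.card) :
    p.coeff (sqfreeExp S) = p.coeff (sqfreeExp T) := by
  obtain ⟨σ, rfl⟩ := exists_perm_map_eq h
  have hσ := hp σ
  rw [permAlgHom_mk, Ideal.Quotient.eq, mem_sqIdeal_iff] at hσ
  have hS := hσ (S.map σ.toEmbedding)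
  rw [MvPolynomial.coeff_sub, sub_eq_zero] at hS
  rw [← hS, ← mapDomain_sqfreeExp, Equiv.coe_toEmbedding,
    MvPolynomial.coeff_rename_mapDomain _ σ.injective]

lemma sum_yB_pow_eq_zero (r : ℕ) : (∑ i : Fin r, yB r i) ^ (r + 1) = 0 := by
  rw [sum_yB, ← map_pow, Ideal.Quotient.eq_zero_iff_mem, mem_sqIdeal_iff]
  intro S
  rw [coeff_sqfreeExp_sum_X_pow, if_neg]
  have := S.card_le_univ
  rw [Fintype.card_fin] at this
  omega

/-- The algebra homomorphism `A_r → B_r` sending `ε` to `y₁ + ⋯ + y_r`. -/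
def truncatedToBr (r : ℕ) : Ar r →ₐ[ℝ] Br r :=
  AdjoinRoot.liftAlgHom _ (Algebra.ofId ℝ (Br r)) (∑ i : Fin r, yB r i)
    (by simpa using sum_yB_pow_eq_zero r)

lemma truncatedToBr_eps (r : ℕ) : truncatedToBr r (eps r) = ∑ i : Fin r, yB r i := by
  simp [truncatedToBr, eps]

lemma truncatedToBr_mk {r : ℕ} (q : Polynomial ℝ) :
    truncatedToBr r (AdjoinRoot.mk _ q) = Ideal.Quotient.mk (sqIdeal r)
      (Polynomial.aeval (∑ i : Fin r, MvPolynomial.X i : MvPolynomial (Fin r) ℝ) q) := by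
  rw [← AdjoinRoot.aeval_eq, ← Polynomial.aeval_algHom_apply]
  change Polynomial.aeval (truncatedToBr r (eps r)) q = _
  rw [truncatedToBr_eps, sum_yB, ← Ideal.Quotient.mkₐ_eq_mk ℝ, Polynomial.aeval_algHom_apply]

lemma truncatedToBr_injective (r : ℕ) : Function.Injective (truncatedToBr r) := by
  rw [injective_iff_map_eq_zero]
  intro x hx
  obtain ⟨q, rfl⟩ := AdjoinRoot.mk_surjective x
  rw [truncatedToBr_mk, Ideal.Quotient.eq_zero_iff_mem, mem_sqIdeal_iff] at hx
  rw [AdjoinRoot.mk_eq_zero, Polynomial.X_pow_dvd_iff]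
  intro k hk
  obtain ⟨S, -, rfl⟩ := Finset.exists_subset_card_eq
    (s := (Finset.univ : Finset (Fin r))) (n := k) (by simpa using Nat.lt_succ_iff.mp hk)
  have hS := hx S
  rw [coeff_sqfreeExp_aeval_sum_X] at hS
  exact (mul_eq_zero.mp hS).resolve_right (by exact_mod_cast S.card.factorial_ne_zero)

lemma permAlgHom_truncatedToBr {r : ℕ} (σ : Equiv.Perm (Fin r)) (a : Ar r) :
    permAlgHom r σ (truncatedToBr r a) = truncatedToBr r a := by
  refine DFunLike.congr_fun (AdjoinRoot.algHom_ext ?_ :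
    (permAlgHom r σ).comp (truncatedToBr r) = truncatedToBr r) a
  change permAlgHom r σ (truncatedToBr r (eps r)) = truncatedToBr r (eps r)
  rw [truncatedToBr_eps, sum_yB, permAlgHom_mk, map_sum]
  simp only [MvPolynomial.rename_X]
  rw [Equiv.sum_comp σ fun i => (MvPolynomial.X i : MvPolynomial (Fin r) ℝ)]

lemma mem_range_truncatedToBr_of_invariant {r : ℕ} {b : Br r}
    (hb : ∀ σ, permAlgHom r σ b = b) : b ∈ Set.range (truncatedToBr r) := by
  obtain ⟨p, rfl⟩ := Ideal.Quotient.mk_surjective b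
  have hc : ∀ k : ℕ, ∃ c : ℝ, ∀ S : Finset (Fin r), S.card = k → p.coeff (sqfreeExp S) = c := by
    intro k
    by_cases h : ∃ T : Finset (Fin r), T.card = k
    · obtain ⟨T, rfl⟩ := h
      exact ⟨_, fun S hS => coeff_sqfreeExp_eq_of_invariant hb hS⟩
    · exact ⟨0, fun S hS => (h ⟨S, hS⟩).elim⟩
  choose c hc using hc
  refine ⟨AdjoinRoot.mk _
    (∑ k ∈ Finset.range (r + 1), Polynomial.monomial k (c k / k.factorial)), ?_⟩
  rw [truncatedToBr_mk, Ideal.Quotient.eq, mem_sqIdeal_iff]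
  intro S
  have hS : S.card < r + 1 := by
    have := S.card_le_univ
    rw [Fintype.card_fin] at this
    omega
  have hf : (S.card.factorial : ℝ) ≠ 0 := by exact_mod_cast S.card.factorial_ne_zero
  rw [MvPolynomial.coeff_sub, coeff_sqfreeExp_aeval_sum_X, hc _ S rfl, Polynomial.finsetSum_coeff]
  simp only [Polynomial.coeff_monomial]
  rw [Finset.sum_ite_eq', if_pos (Finset.mem_range.mpr hS), div_mul_cancel₀ _ hf, sub_self]

/-- `(y₁+⋯+y_r)^{r+1} = 0` in `B_r`; there is a unique `ℝ`-algebra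
homomorphism `Φ : A_r → B_r` with `Φ(ε) = y₁+⋯+y_r`; it is injective, and its image is
the subalgebra of `S_r`-invariants of `B_r`. -/
theorem symmetric_embedding_of_truncated_algebra (r : ℕ) (hr : 1 ≤ r) :
    (∑ i : Fin r, yB r i) ^ (r + 1) = 0 ∧
    ∃ Φ : Ar r →ₐ[ℝ] Br r,
      Φ (eps r) = ∑ i : Fin r, yB r i ∧
      (∀ Φ' : Ar r →ₐ[ℝ] Br r, Φ' (eps r) = ∑ i : Fin r, yB r i → Φ' = Φ) ∧
      Function.Injective Φ ∧
      Set.range Φ = {b : Br r | ∀ σ : Equiv.Perm (Fin r), permAlgHom r σ b = b} := by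
  refine ⟨sum_yB_pow_eq_zero r, truncatedToBr r, truncatedToBr_eps r, ?_,
    truncatedToBr_injective r, ?_⟩
  · intro Φ' h
    exact AdjoinRoot.algHom_ext (h.trans (truncatedToBr_eps r).symm)
  · ext b
    constructor
    · rintro ⟨a, rfl⟩ σ
      exact permAlgHom_truncatedToBr σ a
    · exact mem_range_truncatedToBr_of_invariant
end
end
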